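/- Pieri's rule for Schur polynomials: let m ≥ 1, let λ be a partition with l(λ) ≤ m, and let k ≥ 0. Then in ℤ[X_1,…,X_m] one has S_λ^{(m)} · h_k = Σ_μ S_μ^{(m)}, where the sum runs over all partitions μ with l(μ) ≤ m such that μ/λ is a horizontal strip of size k, each such μ contributing exactly once. -/

import Mathlib

open MvPolynomial

/-- A partition: a weakly decreasing sequence of nonnegative integers with
finitely many nonzero terms. `parts i` is the `(i+1)`-st part `λ_{i+1}`
(0-indexed). -/
structure Partition' where
  parts : ℕ → ℕ
  antitone : Antitone parts
  eventually_zero : ∃ N, parts N = 0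

namespace Partition'

/-- The length `l(λ)`: the number of nonzero parts, i.e. the least index
at which the (weakly decreasing) sequence of parts vanishes. -/
noncomputable def length (lam : Partition') : ℕ := sInf {n | lam.parts n = 0}

/-- The size `|λ| = Σᵢ λᵢ`. -/
noncomputable def size (lam : Partition') : ℕ := ∑ᶠ i, lam.parts i

/-- The partition `(μ_1, …, μ_{r-1})` obtained from `μ` by deleting all parts
from the `r`-th one on. -/
def drop (mu : Partition') (r : ℕ) : Partition' where
  parts i := if i + 1 < r then mu.parts i else 0
  antitone := by
    intro i j hij
    dsimp only
    split_ifs with h1 h2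
    · exact mu.antitone hij
    · omega
    · exact Nat.zero_le _
    · exact le_refl 0
  eventually_zero := ⟨r, if_neg (by omega)⟩

end Partition'

/-- `IsHorizontalStrip mu xi` says that the skew shape `μ/ξ` is a horizontal
strip: `μ_i ≥ ξ_i ≥ μ_{i+1}` for all `i ≥ 1`. -/
def IsHorizontalStrip (mu xi : Partition') : Prop :=
  ∀ i, xi.parts i ≤ mu.parts i ∧ mu.parts (i + 1) ≤ xi.parts i

/-- The size `|μ/ξ| = |μ| - |ξ|` of a skew shape, computed as the sum of
the pointwise differences of the parts. -/
noncomputable def stripSize (mu xi : Partition') : ℕ := ∑ᶠ i, (mu.parts i - xi.parts i)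

/-- The complete homogeneous symmetric polynomial `h_d` in `m` variables over `ℤ`,
extended by `h_d = 0` for `d < 0` (and `h_0 = 1`). -/
noncomputable def hpoly (m : ℕ) (d : ℤ) : MvPolynomial (Fin m) ℤ :=
  if 0 ≤ d then MvPolynomial.hsymm (Fin m) ℤ d.toNat else 0

/-- The Schur polynomial `S_λ^{(m)} ∈ ℤ[X_1,…,X_m]`, defined by the Jacobi–Trudi
formula `S_λ^{(m)} = det (h_{λ_i - i + j})_{1 ≤ i,j ≤ N}` with `N = l(λ)`. -/
noncomputable def schur (m : ℕ) (lam : Partition') : MvPolynomial (Fin m) ℤ :=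
  Matrix.det (Matrix.of fun i j : Fin lam.length =>
    hpoly m ((lam.parts i : ℤ) - (i : ℤ) + (j : ℤ)))

/-- The ring homomorphism `p_n : ℤ[X_1,…,X_{n+1}] → ℤ[X_1,…,X_n]` determined by
`X_i ↦ X_i` for `i ≤ n` and `X_{n+1} ↦ 0`. -/
noncomputable def pmap (n : ℕ) : MvPolynomial (Fin (n + 1)) ℤ →ₐ[ℤ] MvPolynomial (Fin n) ℤ :=
  aeval (fun i : Fin (n + 1) => if h : (i : ℕ) < n then X (⟨i, h⟩ : Fin n) else 0)


theorem det_last_row {R : Type*} [CommRing R] {n : ℕ} (A : Matrix (Fin (n+1)) (Fin (n+1)) R)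
    (h : ∀ j : Fin n, A (Fin.last n) j.castSucc = 0) :
    A.det = A (Fin.last n) (Fin.last n) *
      (Matrix.of fun i j : Fin n => A i.castSucc j.castSucc).det := by
  rw [Matrix.det_succ_row A (Fin.last n), Fin.sum_univ_castSucc]
  simp only [h, mul_zero, zero_mul, Finset.sum_const_zero, zero_add]
  have : (-1 : R) ^ ((Fin.last n : ℕ) + (Fin.last n : ℕ)) = 1 := by
    rw [← two_mul, pow_mul]; simp
  rw [this, one_mul]
  congr 2
  ext i j
  simp

theorem det_col_rev {R : Type*} [CommRing R] {n : ℕ} {A B : Matrix (Fin (n+1)) (Fin (n+1)) R}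
    (c : R) (h0 : ∀ i, A i (Fin.last n) = B i (Fin.last n))
    (hs : ∀ i (j : Fin n), A i j.castSucc = B i j.castSucc + c * A i j.succ) :
    A.det = B.det := by
  rw [← Matrix.det_submatrix_equiv_self Fin.revPerm A,
    ← Matrix.det_submatrix_equiv_self Fin.revPerm B]
  refine Matrix.det_eq_of_forall_col_eq_smul_add_pred (fun _ => c) ?_ ?_
  · intro i
    simpa using h0 i.rev
  · intro i j
    have := hs i.rev j.rev
    simpa [Fin.rev_succ, Fin.rev_castSucc] using this

/-- coefficient of a determinant of power series -/
theorem coeff_det {R : Type*} [CommRing R] {n : ℕ} (k : ℕ)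
    (A : Matrix (Fin n) (Fin n) (PowerSeries R)) :
    PowerSeries.coeff k A.det = ∑ l ∈ Finset.finsuppAntidiag Finset.univ k,
      (Matrix.of fun i j => PowerSeries.coeff (l i) (A i j)).det := by
  rw [← Matrix.det_transpose]
  simp_rw [← fun l : Fin n →₀ ℕ => Matrix.det_transpose
    (Matrix.of fun i j => PowerSeries.coeff (l i) (A i j))]
  simp only [Matrix.det_apply, map_sum]
  rw [Finset.sum_comm]
  refine Finset.sum_congr rfl fun σ _ => ?_
  rw [← Finset.smul_sum, Units.smul_def, Units.smul_def, map_zsmul, PowerSeries.coeff_prod]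
  rfl

theorem pieri_core {R : Type*} [CommRing R] (h : ℤ → R) (hneg : ∀ d, d < 0 → h d = 0)
    (n k : ℕ) (a : ℕ → ℕ) (ha : Antitone a) (han : a n = 0) :
    (Matrix.of fun i j : Fin n => h ((a i : ℤ) - (i : ℤ) + (j : ℤ))).det * h k =
    ∑ l ∈ Finset.finsuppAntidiag (Finset.univ : Finset (Fin (n+1))) k,
      if (∀ i : Fin n, a (i + 1) + l i.succ ≤ a i) then
      (Matrix.of fun i j : Fin (n+1) =>
        h (((a i + l i : ℕ) : ℤ) - (i : ℤ) + (j : ℤ))).det else 0 := by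
  let A : Matrix (Fin (n+1)) (Fin (n+1)) (PowerSeries R) := Matrix.of fun i j =>
    PowerSeries.mk fun b => h (((a i + b : ℕ) : ℤ) - (i : ℤ) + (j : ℤ))
  let B : Matrix (Fin (n+1)) (Fin (n+1)) (PowerSeries R) := Matrix.of fun i j =>
    PowerSeries.mk fun b => if (i : ℕ) = 0 ∨ a i + b ≤ a (i - 1) then
      h (((a i + b : ℕ) : ℤ) - (i : ℤ) + (j : ℤ)) else 0
  let A' : Matrix (Fin (n+1)) (Fin (n+1)) (PowerSeries R) := Matrix.of fun i j =>
    if j = Fin.last n then A i j else PowerSeries.C (h ((a i : ℤ) - (i : ℤ) + (j : ℤ)))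
  have h1 : A.det = B.det := by
    refine Matrix.det_eq_of_forall_row_eq_smul_add_pred
      (fun i : Fin n => PowerSeries.X ^ (a i - a (i + 1) + 1)) ?_ ?_
    · intro j
      simp [A, B]
    · intro i j
      have hi : a (i + 1) ≤ a i := ha (Nat.le_succ _)
      ext b
      simp only [A, B, Matrix.of_apply, map_add, PowerSeries.coeff_mk,
        PowerSeries.coeff_X_pow_mul', Fin.val_succ, Fin.val_castSucc, Nat.add_sub_cancel]
      by_cases hb : a (i + 1) + b ≤ a i
      · rw [if_pos (Or.inr hb), if_neg (by omega), add_zero]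
      · rw [if_neg (by omega), if_pos (by omega), zero_add]
        congr 1
        omega
  have h2 : A.det = A'.det := by
    refine det_col_rev PowerSeries.X ?_ ?_
    · intro i
      simp [A']
    · intro i j
      ext b
      have hj : j.castSucc ≠ Fin.last n := (Fin.castSucc_lt_last j).ne
      cases b with
      | zero => simp [A, A', hj]
      | succ b =>
        simp only [A, A', Matrix.of_apply, map_add, hj, if_false, PowerSeries.coeff_succ_X_mul,
          PowerSeries.coeff_mk, PowerSeries.coeff_C, Fin.val_succ, Fin.val_castSucc]
        simp only [Nat.add_eq_zero_iff, one_ne_zero, and_false, if_false, zero_add]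
        congr 1
        push_cast
        ring
  have h3 : A'.det = (PowerSeries.mk fun b : ℕ => h b) *
      PowerSeries.C (Matrix.of fun i j : Fin n => h ((a i : ℤ) - (i : ℤ) + (j : ℤ))).det := by
    rw [det_last_row]
    · congr 1
      · simp [A', A, han]
      · rw [RingHom.map_det]
        congr 1
        ext i j : 2
        have hj : j.castSucc ≠ Fin.last n := (Fin.castSucc_lt_last j).ne
        simp [A', hj]
    · intro j
      have hj : j.castSucc ≠ Fin.last n := (Fin.castSucc_lt_last j).ne
      have := j.2
      simp only [A', Matrix.of_apply, hj, if_false, Fin.val_last, han, Fin.val_castSucc]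
      rw [hneg _ (by push_cast; omega), map_zero]
  have h4 : PowerSeries.coeff k A.det = PowerSeries.coeff k B.det := by rw [h1]
  rw [h2, h3, PowerSeries.coeff_mul_C, PowerSeries.coeff_mk, coeff_det, mul_comm] at h4
  rw [h4]
  refine Finset.sum_congr rfl fun l _ => ?_
  split_ifs with hl
  · congr 1
    ext i j : 2
    simp only [B, Matrix.of_apply, PowerSeries.coeff_mk]
    rw [if_pos]
    induction i using Fin.cases with
    | zero => simp
    | succ i => right; simpa using hl i
  · push Not at hl
    obtain ⟨i, hi⟩ := hl
    refine Matrix.det_eq_zero_of_row_eq_zero i.succ fun j => ?_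
    simp only [B, Matrix.of_apply, PowerSeries.coeff_mk]
    rw [if_neg]
    simp only [Fin.val_succ, Nat.add_sub_cancel]
    omega

theorem hpoly_neg (m : ℕ) (d : ℤ) (hd : d < 0) : hpoly m d = 0 := if_neg (by omega)

theorem hpoly_zero (m : ℕ) : hpoly m 0 = 1 := by simp [hpoly]

theorem hpoly_nat (m n : ℕ) : hpoly m n = MvPolynomial.hsymm (Fin m) ℤ n := by simp [hpoly]

theorem length_le_iff (mu : Partition') (n : ℕ) : mu.length ≤ n ↔ mu.parts n = 0 := by
  have h0 : mu.parts mu.length = 0 := Nat.sInf_mem (s := {n | mu.parts n = 0}) mu.eventually_zero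
  constructor
  · intro h
    have := mu.antitone h
    omega
  · intro h
    exact Nat.sInf_le h

theorem schur_eq (m : ℕ) (mu : Partition') (n : ℕ) (hn : mu.length ≤ n) :
    schur m mu = (Matrix.of fun i j : Fin n =>
      hpoly m ((mu.parts i : ℤ) - (i : ℤ) + (j : ℤ))).det := by
  induction n, hn using Nat.le_induction with
  | base => rfl
  | succ n hn ih =>
    have h0 := (length_le_iff mu n).1 hn
    rw [det_last_row]
    · simp only [Matrix.of_apply, Fin.val_last, h0, Fin.val_castSucc]
      rw [ih]
      simp [hpoly_zero]
    · intro j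
      have := j.2
      simp only [Matrix.of_apply, Fin.val_last, h0, Fin.val_castSucc]
      exact hpoly_neg _ _ (by push_cast; omega)

theorem hsymm_gen (m n : ℕ) : MvPolynomial.hsymm (Fin m) ℤ n =
    PowerSeries.coeff n (∏ i : Fin m,
      (PowerSeries.mk fun b => (X i : MvPolynomial (Fin m) ℤ) ^ b)) := by
  rw [PowerSeries.coeff_prod, MvPolynomial.hsymm]
  refine Finset.sum_bij' (fun s _ => Multiset.toFinsupp s.1)
    (fun l hl => ⟨Finsupp.toMultiset l, ?_⟩) ?_ ?_ ?_ ?_ ?_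
  · rw [Finset.mem_finsuppAntidiag] at hl
    rw [Finsupp.card_toMultiset, Finsupp.sum_fintype _ _ (by simp)]
    exact hl.1
  · intro s _
    simp only [Finset.mem_finsuppAntidiag, Finset.subset_univ, and_true]
    have h1 := Finsupp.card_toMultiset (Multiset.toFinsupp s.1)
    rw [Finsupp.sum_fintype _ _ (by simp), Multiset.toFinsupp_toMultiset] at h1
    exact h1.symm.trans s.2
  · intros; exact Finset.mem_univ _
  · intro s _
    ext1
    simp
  · intro l _
    simp
  · intro s _
    simp only [PowerSeries.coeff_mk, Multiset.toFinsupp_apply]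
    rw [Finset.prod_multiset_map_count]
    refine Finset.prod_subset (Finset.subset_univ _) ?_
    intro i _ hi
    rw [Multiset.mem_toFinset] at hi
    have h0 : Multiset.count i s.1 = 0 := Multiset.count_eq_zero_of_notMem hi
    exact (congrArg _ h0).trans (pow_zero _)

theorem hpoly_rec (m : ℕ) : ∃ c : ℕ → MvPolynomial (Fin m) ℤ, c 0 = 1 ∧
    ∀ d : ℤ, 1 ≤ d → ∑ j ∈ Finset.range (m + 1), c j * hpoly m (d - j) = 0 := by
  let P : Polynomial (MvPolynomial (Fin m) ℤ) :=
    ∏ i : Fin m, (1 - Polynomial.C (X i) * Polynomial.X)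
  have hdeg : P.natDegree ≤ m := by
    refine (Polynomial.natDegree_prod_le _ _).trans ?_
    refine (Finset.sum_le_card_nsmul _ _ 1 ?_).trans (by simp)
    intro i _
    compute_degree
  let H : PowerSeries (MvPolynomial (Fin m) ℤ) := ∏ i : Fin m,
      (PowerSeries.mk fun b => (X i : MvPolynomial (Fin m) ℤ) ^ b)
  have hPH : (P : PowerSeries (MvPolynomial (Fin m) ℤ)) * H = 1 := by
    have : (P : PowerSeries (MvPolynomial (Fin m) ℤ)) =
        ∏ i : Fin m, (1 - PowerSeries.C (X i) * PowerSeries.X) := by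
      rw [← Polynomial.coeToPowerSeries.ringHom_apply, map_prod]
      simp
    rw [this, ← Finset.prod_mul_distrib]
    refine Finset.prod_eq_one fun i _ => ?_
    ext1 b
    rw [sub_mul, one_mul, mul_assoc, map_sub, PowerSeries.coeff_C_mul]
    cases b with
    | zero => simp
    | succ b =>
      rw [PowerSeries.coeff_succ_X_mul]
      simp [PowerSeries.coeff_one, pow_succ']
  refine ⟨fun j => P.coeff j, ?_, ?_⟩
  · simp [P, Polynomial.coeff_zero_eq_eval_zero, Polynomial.eval_prod]
  · intro d hd
    lift d to ℕ using by omega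
    have h1 := congrArg (PowerSeries.coeff d) hPH
    rw [PowerSeries.coeff_one, if_neg (by omega), PowerSeries.coeff_mul,
      Finset.Nat.sum_antidiagonal_eq_sum_range_succ
        (fun i j => PowerSeries.coeff i (P : PowerSeries (MvPolynomial (Fin m) ℤ)) *
          PowerSeries.coeff j H)] at h1
    have h2 : ∑ j ∈ Finset.range (d + 1), P.coeff j * hpoly m ((d : ℤ) - j) = 0 := by
      rw [← h1]
      refine Finset.sum_congr rfl fun j hj => ?_
      rw [Finset.mem_range] at hj
      rw [Polynomial.coeff_coe, ← hsymm_gen, ← hpoly_nat, Nat.cast_sub (by omega)]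
    rw [← h2]
    have e1 : ∑ j ∈ Finset.range (m + 1), P.coeff j * hpoly m ((d : ℤ) - j) =
        ∑ j ∈ Finset.range (m + d + 1), P.coeff j * hpoly m ((d : ℤ) - j) := by
      refine Finset.sum_subset (by intro x; simp only [Finset.mem_range]; omega) ?_
      intro x _ hx
      rw [Finset.mem_range] at hx
      rw [Polynomial.coeff_eq_zero_of_natDegree_lt (by omega), zero_mul]
    have e2 : ∑ j ∈ Finset.range (d + 1), P.coeff j * hpoly m ((d : ℤ) - j) =
        ∑ j ∈ Finset.range (m + d + 1), P.coeff j * hpoly m ((d : ℤ) - j) := by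
      refine Finset.sum_subset (by intro x; simp only [Finset.mem_range]; omega) ?_
      intro x _ hx
      rw [Finset.mem_range] at hx
      rw [hpoly_neg _ _ (by omega), mul_zero]
    rw [e1, e2]

theorem schur_vanish (m : ℕ) (mu : Partition') (h1 : mu.length ≤ m + 1) (h2 : mu.parts m ≠ 0) :
    schur m mu = 0 := by
  rw [schur_eq m mu _ h1]
  obtain ⟨c, c0, hc⟩ := hpoly_rec m
  rw [← Matrix.exists_mulVec_eq_zero_iff]
  refine ⟨fun j => c (m - j), ?_, ?_⟩
  · intro h
    have := congrFun h (Fin.last m)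
    simp [c0] at this
  · ext1 i
    have hi : mu.parts m ≤ mu.parts i := mu.antitone (by omega)
    have := hc ((mu.parts i : ℤ) - (i : ℤ) + m) (by omega)
    rw [← Finset.sum_range_reflect, Finset.sum_range] at this
    simp only [Matrix.mulVec, dotProduct, Matrix.of_apply, Pi.zero_apply]
    rw [← this]
    refine Finset.sum_congr rfl fun j _ => ?_
    rw [mul_comm]
    have hj := j.2
    congr 2
    · omega

theorem stripSize_eq (mu lam : Partition') (n : ℕ) (h : mu.length ≤ n) :
    stripSize mu lam = ∑ i : Fin n, (mu.parts i - lam.parts i) := by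
  rw [stripSize, finsum_eq_sum_of_support_subset (s := Finset.range n), Finset.sum_range]
  intro i hi
  rw [Function.mem_support] at hi
  simp only [Finset.coe_range, Set.mem_Iio]
  by_contra hc
  have h1 := (length_le_iff mu n).1 h
  have h2 := mu.antitone (show n ≤ i by omega)
  omega

/-- **Pieri's rule for Schur polynomials.** For `m ≥ 1`, a partition `λ` with
`l(λ) ≤ m` and `k ≥ 0`, in `ℤ[X_1,…,X_m]` one has
`S_λ^{(m)} · h_k = Σ_μ S_μ^{(m)}`, the sum running over all partitions `μ` with
`l(μ) ≤ m` such that `μ/λ` is a horizontal strip of size `k`, each such `μ`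
contributing exactly once. -/
theorem pieri_rule_schur (m : ℕ) (hm : 1 ≤ m) (lam : Partition')
    (hlam : lam.length ≤ m) (k : ℕ) :
    schur m lam * hpoly m (k : ℤ) =
      ∑ᶠ mu ∈ {mu : Partition' |
          mu.length ≤ m ∧ IsHorizontalStrip mu lam ∧ stripSize mu lam = k},
        schur m mu := by
  have hl0 := (length_le_iff lam m).1 hlam
  rw [schur_eq m lam m hlam, pieri_core (hpoly m) (hpoly_neg m) m k lam.parts lam.antitone hl0,
    ← Finset.sum_filter]
  have e1 : ∑ᶠ mu ∈ {mu : Partition' |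
          mu.length ≤ m ∧ IsHorizontalStrip mu lam ∧ stripSize mu lam = k}, schur m mu =
      ∑ᶠ mu ∈ {mu : Partition' |
          mu.length ≤ m + 1 ∧ IsHorizontalStrip mu lam ∧ stripSize mu lam = k}, schur m mu := by
    refine finsum_mem_inter_support_eq' _ _ _ fun mu hmu => ?_
    simp only [Set.mem_ofPred_eq]
    refine ⟨fun h => ⟨by omega, h.2⟩, fun h => ⟨?_, h.2⟩⟩
    rw [length_le_iff]
    by_contra hc
    exact hmu (schur_vanish m mu h.1 hc)
  rw [e1, ← finsum_mem_coe_finset]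
  symm
  refine finsum_mem_eq_of_bijOn (fun mu : Partition' =>
    Finsupp.equivFunOnFinite.symm fun i : Fin (m+1) => mu.parts i - lam.parts i) ?_ ?_
  · refine ⟨?_, ?_, ?_⟩
    · rintro mu ⟨h1, h2, h3⟩
      simp only [Finset.coe_filter, Finset.mem_finsuppAntidiag, Finset.subset_univ, and_true,
        Set.mem_ofPred_eq, Finsupp.equivFunOnFinite_symm_apply_apply, Fin.val_succ]
      refine ⟨?_, ?_⟩
      · rw [← h3, stripSize_eq mu lam _ h1]
      · intro i
        have := h2 i
        have := h2 (i + 1)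
        omega
    · rintro mu ⟨h1, h2, h3⟩ nu ⟨h1', h2', h3'⟩ heq
      have hp : mu.parts = nu.parts := by
        funext i
        by_cases hi : i < m + 1
        · have := DFunLike.congr_fun heq ⟨i, hi⟩
          simp only [Finsupp.equivFunOnFinite_symm_apply_apply] at this
          have := h2 i
          have := h2' i
          omega
        · have a1 := mu.antitone (show m + 1 ≤ i by omega)
          have a2 := nu.antitone (show m + 1 ≤ i by omega)
          rw [length_le_iff] at h1 h1'
          omega
      cases mu
      cases nu
      simp only at hp
      subst hp
      rfl
    · intro l hl
      simp only [Finset.coe_filter, Finset.mem_finsuppAntidiag, Finset.subset_univ, and_true,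
        Set.mem_ofPred_eq] at hl
      obtain ⟨hl1, hl2⟩ := hl
      let p : ℕ → ℕ := fun i => if hi : i < m + 1 then lam.parts i + l ⟨i, hi⟩ else 0
      have hp1 : ∀ i, p (i + 1) ≤ lam.parts i := by
        intro i
        by_cases hi : i < m
        · have := hl2 ⟨i, hi⟩
          simp only [p]
          rw [dif_pos (by omega)]
          exact this
        · simp only [p]
          rw [dif_neg (by omega)]
          omega
      have hp2 : ∀ i, lam.parts i ≤ p i := by
        intro i
        simp only [p]
        split_ifs with hi
        · omega
        · have := lam.antitone (show m ≤ i by omega)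
          omega
      have hp3 : p (m + 1) = 0 := by simp [p]
      let mu : Partition' := ⟨p, antitone_nat_of_succ_le fun i => (hp1 i).trans (hp2 i), m + 1, hp3⟩
      have hlen : mu.length ≤ m + 1 := (length_le_iff _ _).2 hp3
      have hd : ∀ i : Fin (m + 1), mu.parts i - lam.parts i = l i := by
        intro i
        have hi : (i : ℕ) < m + 1 := i.2
        simp only [mu, p]
        rw [dif_pos hi]
        exact Nat.add_sub_cancel_left _ _
      refine ⟨mu, ⟨hlen, fun i => ⟨hp2 i, hp1 i⟩, ?_⟩, ?_⟩
      · rw [stripSize_eq mu lam _ hlen, ← hl1]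
        exact Finset.sum_congr rfl fun i _ => hd i
      · ext i
        simpa using hd i
  · rintro mu ⟨h1, h2, h3⟩
    rw [schur_eq m mu _ h1]
    congr 1
    ext1 i j
    simp only [Matrix.of_apply, Finsupp.equivFunOnFinite_symm_apply_apply]
    congr 4
    have := h2 i
    omega
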